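/- For all positive integers d_A and d_B, all unitary matrices T₁, U₁ ∈ M_{d_A}(ℂ) and T₂, U₂ ∈ M_{d_B}(ℂ), and all unit vectors ζ₁, ζ₂ ∈ ℂ^{d_A} ⊗ ℂ^{d_B}, it is impossible that all of the following hold simultaneously: ⟨(U₁ ⊗ U₂)ζ₁, ζ₂⟩ = ⟨(U₁ ⊗ U₂)ζ₁, ζ₁⟩ = 1/√2; ⟨(T₁ ⊗ I)ζ₁, ζ₁⟩ = ⟨(I ⊗ T₂)ζ₁, ζ₁⟩ = 1; and ⟨(T₁ ⊗ I)ζ₂, ζ₂⟩ = ⟨(I ⊗ T₂)ζ₂, ζ₂⟩ = −1. (Equivalently: the correlations of Theorem 1.4 of the paper cannot be witnessed on a tensor product of finite-dimensional Hilbert spaces.) -/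

import Mathlib

open Matrix Kronecker

/-- Inner product on `ι → ℂ`, linear in the first argument and
conjugate-linear in the second. -/
noncomputable def ip {ι : Type*} [Fintype ι] (x y : ι → ℂ) : ℂ :=
  ∑ i, x i * (starRingEnd ℂ) (y i)

/-- `1/√2` as a complex number. -/
noncomputable def invSqrt2 : ℂ := 1 / (Real.sqrt 2 : ℂ)

theorem ip_eq_dotProduct {ι : Type*} [Fintype ι] (x y : ι → ℂ) : ip x y = x ⬝ᵥ star y := rfl

theorem star_ip {ι : Type*} [Fintype ι] (x y : ι → ℂ) : star (ip x y) = ip y x := by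
  rw [ip_eq_dotProduct, ip_eq_dotProduct, ← star_dotProduct_star, star_star]

open scoped ComplexOrder in
theorem ip_self_eq_zero {ι : Type*} [Fintype ι] {x : ι → ℂ} : ip x x = 0 ↔ x = 0 :=
  dotProduct_self_star_eq_zero

theorem ip_mulVec_mulVec {ι : Type*} [Fintype ι] [DecidableEq ι] {A : Matrix ι ι ℂ}
    (hA : A ∈ unitaryGroup ι ℂ) (x y : ι → ℂ) : ip (A *ᵥ x) (A *ᵥ y) = ip x y := by
  rw [ip_eq_dotProduct, ip_eq_dotProduct, star_mulVec, dotProduct_comm, ← dotProduct_mulVec,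
    mulVec_mulVec, ← star_eq_conjTranspose, mem_unitaryGroup_iff'.1 hA, one_mulVec,
    dotProduct_comm]

/-- The equality case of the Cauchy–Schwarz inequality for unit vectors. -/
theorem eq_smul_of_ip_eq {ι : Type*} [Fintype ι] {x y : ι → ℂ} {c : ℂ} (hx : ip x x = 1)
    (hy : ip y y = 1) (hc : c * star c = 1) (h : ip y x = c) : y = c • x := by
  have h' : ip x y = star c := by rw [← star_ip, h]
  rw [← sub_eq_zero, ← ip_self_eq_zero, ip_eq_dotProduct]
  simp only [ip_eq_dotProduct] at hx hy h h'
  simp only [star_sub, star_smul, sub_dotProduct, dotProduct_sub, smul_dotProduct,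
    dotProduct_smul, smul_eq_mul, hx, hy, h, h']
  linear_combination -hc

/-- Bessel's equality for two orthonormal vectors with both coefficients equal to `1/√2`. -/
theorem eq_invSqrt2_smul_add {ι : Type*} [Fintype ι] {x₁ x₂ y : ι → ℂ} (h₁ : ip x₁ x₁ = 1)
    (h₂ : ip x₂ x₂ = 1) (h₁₂ : ip x₁ x₂ = 0) (hy : ip y y = 1) (hy₁ : ip y x₁ = invSqrt2)
    (hy₂ : ip y x₂ = invSqrt2) : y = invSqrt2 • (x₁ + x₂) := by
  have hstar : star invSqrt2 = invSqrt2 := by simp [invSqrt2]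
  have hsq : invSqrt2 * invSqrt2 = 1 / 2 := by
    have h : (Real.sqrt 2 : ℂ) * Real.sqrt 2 = 2 := by
      exact_mod_cast Real.mul_self_sqrt (by norm_num : (0 : ℝ) ≤ 2)
    rw [invSqrt2, div_mul_div_comm, h, one_mul]
  have h₂₁ : ip x₂ x₁ = 0 := by rw [← star_ip, h₁₂, star_zero]
  have hy₁' : ip x₁ y = invSqrt2 := by rw [← star_ip, hy₁, hstar]
  have hy₂' : ip x₂ y = invSqrt2 := by rw [← star_ip, hy₂, hstar]
  rw [← sub_eq_zero, ← ip_self_eq_zero]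
  simp only [ip_eq_dotProduct] at *
  simp only [star_sub, star_add, star_smul, sub_dotProduct, dotProduct_sub, add_dotProduct,
    dotProduct_add, smul_dotProduct, dotProduct_smul, smul_eq_mul, *]
  linear_combination -2 * hsq

theorem mul_eq_zero_of_rank_mul_eq {K l m n p : Type*} [Field K] [Fintype m] [Fintype n]
    [Fintype p] [DecidableEq p] {A : Matrix l m K} {B : Matrix m n K} {C : Matrix n p K}
    (hrank : (A * B).rank = B.rank) (h : A * B * C = 0) : B * C = 0 := by
  have hle : LinearMap.ker B.mulVecLin ≤ LinearMap.ker (A * B).mulVecLin := by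
    rw [mulVecLin_mul]
    exact LinearMap.ker_le_ker_comp _ _
  have hker : LinearMap.ker B.mulVecLin = LinearMap.ker (A * B).mulVecLin := by
    refine Submodule.eq_of_le_of_finrank_eq hle ?_
    have hB := B.mulVecLin.finrank_range_add_finrank_ker
    have hAB := (A * B).mulVecLin.finrank_range_add_finrank_ker
    simp only [Matrix.rank] at hrank
    omega
  refine ext_of_mulVec_single fun i => ?_
  have hmem : C *ᵥ Pi.single i 1 ∈ LinearMap.ker B.mulVecLin := by
    rw [hker, LinearMap.mem_ker, mulVecLin_apply, mulVec_mulVec, h, zero_mulVec]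
  rwa [LinearMap.mem_ker, mulVecLin_apply, mulVec_mulVec, ← zero_mulVec (Pi.single i 1)] at hmem

/-- Two matrices that lie in the `1`- and `-1`-eigenspaces of both a left and a right
multiplication have independent row and column spaces, so the second one vanishes as soon as
adding it to the first does not change the rank. -/
theorem eq_zero_of_rank_add_eq {m n : Type*} [Fintype m] [Fintype n] [DecidableEq m]
    [DecidableEq n] {X Y : Matrix m n ℂ} {S : Matrix m m ℂ} {T : Matrix n n ℂ}
    (hSX : S * X = X) (hSY : S * Y = -Y) (hXT : X * T = X) (hYT : Y * T = -Y)
    (hrank : X.rank = (X + Y).rank) : Y = 0 := by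
  have hproj : ((1 / 2 : ℂ) • (1 + S)) * (X + Y) = X := by
    rw [smul_mul, Matrix.add_mul, Matrix.one_mul, Matrix.mul_add, hSX, hSY]
    module
  have hzero : (X + Y) * (1 - T) = 0 := by
    refine mul_eq_zero_of_rank_mul_eq (A := (1 / 2 : ℂ) • (1 + S)) (by rw [hproj, hrank]) ?_
    rw [hproj, Matrix.mul_sub, Matrix.mul_one, hXT, sub_self]
  rw [Matrix.mul_sub, Matrix.mul_one, Matrix.add_mul, hXT, hYT] at hzero
  have h2 : (2 : ℂ) • Y = 0 := by
    rw [← hzero]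
    module
  exact (smul_eq_zero.1 h2).resolve_left two_ne_zero

/-- The correlations of Theorem 1.4 (equations (1)–(3)) cannot be witnessed on a
tensor product of finite-dimensional Hilbert spaces. -/
theorem stmt0 (dA dB : ℕ) (hdA : 0 < dA) (hdB : 0 < dB)
    (T₁ U₁ : Matrix (Fin dA) (Fin dA) ℂ) (T₂ U₂ : Matrix (Fin dB) (Fin dB) ℂ)
    (hT₁ : T₁ ∈ Matrix.unitaryGroup (Fin dA) ℂ)
    (hU₁ : U₁ ∈ Matrix.unitaryGroup (Fin dA) ℂ)
    (hT₂ : T₂ ∈ Matrix.unitaryGroup (Fin dB) ℂ)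
    (hU₂ : U₂ ∈ Matrix.unitaryGroup (Fin dB) ℂ)
    (ζ₁ ζ₂ : Fin dA × Fin dB → ℂ)
    (hζ₁ : ip ζ₁ ζ₁ = 1) (hζ₂ : ip ζ₂ ζ₂ = 1) :
    ¬ (ip ((U₁ ⊗ₖ U₂).mulVec ζ₁) ζ₂ = invSqrt2 ∧
       ip ((U₁ ⊗ₖ U₂).mulVec ζ₁) ζ₁ = invSqrt2 ∧
       ip ((T₁ ⊗ₖ (1 : Matrix (Fin dB) (Fin dB) ℂ)).mulVec ζ₁) ζ₁ = 1 ∧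
       ip (((1 : Matrix (Fin dA) (Fin dA) ℂ) ⊗ₖ T₂).mulVec ζ₁) ζ₁ = 1 ∧
       ip ((T₁ ⊗ₖ (1 : Matrix (Fin dB) (Fin dB) ℂ)).mulVec ζ₂) ζ₂ = -1 ∧
       ip (((1 : Matrix (Fin dA) (Fin dA) ℂ) ⊗ₖ T₂).mulVec ζ₂) ζ₂ = -1) := by
  rintro ⟨hW₂, hW₁, hTA₁, hTB₁, hTA₂, hTB₂⟩
  have hW := kronecker_mem_unitary hU₁ hU₂
  have hTA := kronecker_mem_unitary hT₁ (one_mem (unitaryGroup (Fin dB) ℂ))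
  have hTB := kronecker_mem_unitary (one_mem (unitaryGroup (Fin dA) ℂ)) hT₂
  replace hTA₁ := eq_smul_of_ip_eq hζ₁ (by rwa [ip_mulVec_mulVec hTA]) (by simp) hTA₁
  replace hTB₁ := eq_smul_of_ip_eq hζ₁ (by rwa [ip_mulVec_mulVec hTB]) (by simp) hTB₁
  replace hTA₂ := eq_smul_of_ip_eq hζ₂ (by rwa [ip_mulVec_mulVec hTA]) (by simp) hTA₂
  replace hTB₂ := eq_smul_of_ip_eq hζ₂ (by rwa [ip_mulVec_mulVec hTB]) (by simp) hTB₂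
  have hortho : ip ζ₁ ζ₂ = 0 := by
    have h := ip_mulVec_mulVec hTA ζ₁ ζ₂
    rw [hTA₁, hTA₂, one_smul, neg_one_smul, ip_eq_dotProduct, star_neg, dotProduct_neg,
      ← ip_eq_dotProduct] at h
    exact self_eq_neg.1 h.symm
  have hsum := eq_invSqrt2_smul_add hζ₁ hζ₂ hortho (by rwa [ip_mulVec_mulVec hW]) hW₁ hW₂
  obtain ⟨X, rfl⟩ := vec_bijective.surjective ζ₁
  obtain ⟨Y, rfl⟩ := vec_bijective.surjective ζ₂
  simp only [kronecker_mulVec_vec, ← vec_add, ← vec_smul, ← vec_neg, vec_inj, one_smul, neg_one_smul,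
    transpose_one, Matrix.mul_one, Matrix.one_mul] at hTA₁ hTA₂ hTB₁ hTB₂ hsum
  have hdet {n : ℕ} {U : Matrix (Fin n) (Fin n) ℂ} (hU : U ∈ unitaryGroup (Fin n) ℂ) :
      IsUnit U.det := (isUnit_iff_isUnit_det U).1 (Unitary.isUnit_coe (U := ⟨U, hU⟩))
  have hrank : X.rank = (X + Y).rank := by
    have hc : invSqrt2 ≠ 0 := by simp [invSqrt2]
    rw [← rank_smul_of_mem_nonZeroDivisors (X + Y) (mem_nonZeroDivisors_of_ne_zero hc), ← hsum,
      rank_mul_eq_left_of_isUnit_det _ _ (by rw [det_transpose]; exact hdet hU₁),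
      rank_mul_eq_right_of_isUnit_det _ _ (hdet hU₂)]
  have hY := eq_zero_of_rank_add_eq hTB₁ hTB₂ hTA₁ hTA₂ hrank
  simp [hY, ip] at hζ₂
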